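/- There exists a universal constant C > 0 with the following property. Let (X,d_X) be a finite metric space with n points admitting a (τ,ρ)-LSO with ρ ∈ (0,1/2), and let f ≥ 1 be an integer. Then there is a set H of unordered pairs of points of X with |H| ≤ C·n·f·τ·(1 + log n) such that for every set F ⊆ X with |F| ≤ f and every x,y ∈ X \ F, there exists z ∈ X \ F with d_X(x,z) + d_X(z,y) ≤ (1 + 2ρ)·d_X(x,y), where each of the pairs {x,z} and {z,y} is either degenerate (its two points coincide) or belongs to H. (In particular H is a 2-hop f-fault-tolerant (1+2ρ)-spanner of X.) -/

import Mathlib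

/-- A `(τ, ρ)`-LSO for the distance function `dX` on `X`. -/
def IsLSO {X : Type*} (dX : X → X → ℝ) (τ ρ : ℝ) : Prop :=
  ∃ (m : ℕ) (σ : Fin m → X → X → Prop),
    (m : ℝ) ≤ τ ∧ (∀ i, IsLinearOrder X (σ i)) ∧
    ∀ x y : X, ∃ i : Fin m,
      (∃ c : X, σ i x c ∧ σ i c y ∧
        (∀ z : X, σ i x z → σ i z c → dX x z ≤ ρ * dX x y) ∧
        (∀ z : X, ¬ σ i z c → σ i z y → dX y z ≤ ρ * dX x y)) ∨
      (∃ c : X, σ i y c ∧ σ i c x ∧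
        (∀ z : X, σ i y z → σ i z c → dX y z ≤ ρ * dX x y) ∧
        (∀ z : X, ¬ σ i z c → σ i z x → dX x z ≤ ρ * dX x y))

/-- A list sorted by an antisymmetric reflexive relation and of length less than `2 ^ k` carries a
graph with at most `L.length * (f + 1) * k` edges in which any two related points are joined, after
deleting any `f` other points, by a monotone path of at most two edges. -/
lemma exists_monotone_two_hop_edges {X : Type*} [DecidableEq X] (r : X → X → Prop)
    (hrefl : ∀ a, r a a) (hanti : ∀ a b, r a b → r b a → a = b) (f k : ℕ) (L : List X)
    (hL : L.Pairwise r) (hnd : L.Nodup) (hlen : L.length < 2 ^ k) :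
    ∃ H : Finset (Sym2 X), H.card ≤ L.length * (f + 1) * k ∧
      ∀ F : Finset X, F.card ≤ f → ∀ x ∈ L, ∀ y ∈ L, x ∉ F → y ∉ F → r x y →
        ∃ z, z ∉ F ∧ r x z ∧ r z y ∧ (x = z ∨ s(x, z) ∈ H) ∧ (z = y ∨ s(z, y) ∈ H) := by
  induction k generalizing L with
  | zero =>
    obtain rfl : L = [] := List.length_eq_zero_iff.mp (by simpa using hlen)
    exact ⟨∅, by simp, by simp⟩
  | succ k ih =>
    obtain ⟨A, M, B, rfl, hA, hB, hM, hMB⟩ : ∃ A M B : List X, L = A ++ (M ++ B) ∧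
        A.length < 2 ^ k ∧ B.length < 2 ^ k ∧ M.length ≤ f + 1 ∧
        (B = [] ∨ M.length = f + 1) := by
      have hpow : 2 ^ (k + 1) = 2 * 2 ^ k := by ring
      refine ⟨L.take (L.length / 2), (L.drop (L.length / 2)).take (f + 1),
        (L.drop (L.length / 2)).drop (f + 1), by simp only [List.take_append_drop], ?_, ?_, ?_, ?_⟩
      · rw [List.length_take]; omega
      · simp only [List.length_drop]; omega
      · rw [List.length_take]; omega
      · rw [← List.length_eq_zero_iff]
        simp only [List.length_take, List.length_drop]; omega
    rw [List.pairwise_append, List.pairwise_append] at hL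
    obtain ⟨hLA, ⟨-, hLB, hrMB⟩, hrA⟩ := hL
    rw [List.nodup_append, List.nodup_append] at hnd
    obtain ⟨hndA, ⟨hndM, hndB, -⟩, -⟩ := hnd
    obtain ⟨HA, hHA, hpA⟩ := ih A hLA hndA hA
    obtain ⟨HB, hHB, hpB⟩ := ih B hLB hndB hB
    set L := A ++ (M ++ B) with hLdef
    let HM : Finset (Sym2 X) := (L.toFinset ×ˢ M.toFinset).image fun p => s(p.1, p.2)
    have hHM : HM.card ≤ L.length * (f + 1) :=
      Finset.card_image_le.trans <| by
        rw [Finset.card_product]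
        exact Nat.mul_le_mul L.toFinset_card_le (M.toFinset_card_le.trans hM)
    have mem_HM : ∀ a ∈ L, ∀ b ∈ M, s(a, b) ∈ HM := fun a ha b hb =>
      Finset.mem_image.mpr ⟨(a, b), by simp [ha, hb], rfl⟩
    refine ⟨HM ∪ (HA ∪ HB), ?_, ?_⟩
    · have hlenL : A.length + B.length ≤ L.length := by simp [hLdef]
      calc (HM ∪ (HA ∪ HB)).card ≤ HM.card + (HA.card + HB.card) :=
            (Finset.card_union_le _ _).trans (by gcongr; exact Finset.card_union_le _ _)
        _ ≤ L.length * (f + 1) + (A.length + B.length) * (f + 1) * k := by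
            rw [add_mul, add_mul]; gcongr
        _ ≤ L.length * (f + 1) + L.length * (f + 1) * k := by gcongr
        _ = L.length * (f + 1) * (k + 1) := by ring
    · intro F hF x hx y hy hxF hyF hxy
      by_cases hxM : x ∈ M
      · exact ⟨x, hxF, hrefl x, hxy, .inl rfl,
          .inr (Finset.mem_union_left _ (Sym2.eq_swap ▸ mem_HM y hy x hxM))⟩
      by_cases hyM : y ∈ M
      · exact ⟨y, hyF, hxy, hrefl y, .inr (Finset.mem_union_left _ (mem_HM x hx y hyM)), .inl rfl⟩
      have hxAB : x ∈ A ∨ x ∈ B := by simpa [hLdef, hxM] using hx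
      have hyAB : y ∈ A ∨ y ∈ B := by simpa [hLdef, hyM] using hy
      rcases hxAB with hxA | hxB <;> rcases hyAB with hyA | hyB
      · obtain ⟨z, hz, hxz, hzy, h₁, h₂⟩ := hpA F hF x hxA y hyA hxF hyF hxy
        exact ⟨z, hz, hxz, hzy, h₁.imp_right (by simp +contextual),
          h₂.imp_right (by simp +contextual)⟩
      · have hcard : F.card < M.toFinset.card := by
          rw [List.toFinset_card_of_nodup hndM]
          rcases hMB with rfl | h
          · simp at hyB
          · omega
        obtain ⟨z, hzM, hzF⟩ := Finset.exists_mem_notMem_of_card_lt_card hcard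
        rw [List.mem_toFinset] at hzM
        exact ⟨z, hzF, hrA x hxA z (by simp [hzM]), hrMB z hzM y hyB,
          .inr (Finset.mem_union_left _ (mem_HM x hx z hzM)),
          .inr (Finset.mem_union_left _ (Sym2.eq_swap ▸ mem_HM y hy z hzM))⟩
      · obtain rfl := hanti x y hxy (hrA y hyA x (by simp [hxB]))
        exact ⟨x, hxF, hxy, hxy, .inl rfl, .inl rfl⟩
      · obtain ⟨z, hz, hxz, hzy, h₁, h₂⟩ := hpB F hF x hxB y hyB hxF hyF hxy
        exact ⟨z, hz, hxz, hzy, h₁.imp_right (by simp +contextual),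
          h₂.imp_right (by simp +contextual)⟩

/-- A point of an order interval all of whose points up to `c` are near `x` and all of whose points
beyond `c` are near `y` is a good midpoint for `x` and `y`. -/
lemma dist_add_dist_le_of_between {X : Type*} [PseudoMetricSpace X] {r : X → X → Prop} {ρ : ℝ}
    {x y c z : X} (hx : ∀ z, r x z → r z c → dist x z ≤ ρ * dist x y)
    (hy : ∀ z, ¬ r z c → r z y → dist y z ≤ ρ * dist x y) (hxz : r x z) (hzy : r z y) :
    dist x z + dist z y ≤ (1 + 2 * ρ) * dist x y := by
  by_cases hzc : r z c
  · linarith [hx z hxz hzc, dist_triangle_left z y x]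
  · linarith [hy z hzc hzy, dist_triangle_right x z y, dist_comm y z]

lemma natLog_two_add_one_le (n : ℕ) : ((Nat.log 2 n + 1 : ℕ) : ℝ) ≤ 2 * (1 + Real.log n) := by
  have h := Real.natLog_le_logb n 2
  have hlog : 0 ≤ Real.log n := Real.log_natCast_nonneg n
  have hlogb : Real.logb 2 n ≤ 2 * Real.log n := by
    rw [Real.logb, div_le_iff₀ (Real.log_pos one_lt_two)]
    nlinarith [Real.log_two_gt_d9]
  push_cast at h ⊢
  linarith

/-- **2-hop fault-tolerant spanner from an LSO.**  There is a universal constant `C > 0` such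
that every finite metric space on `n` points admitting a `(τ, ρ)`-LSO with `ρ ∈ (0, 1/2)` has,
for every `f ≥ 1`, a 2-hop `f`-fault-tolerant `(1 + 2ρ)`-spanner with at most
`C·n·f·τ·(1 + log n)` edges. -/
theorem two_hop_fault_tolerant_spanner_from_LSO :
    ∃ C : ℝ, 0 < C ∧
      ∀ (X : Type) [MetricSpace X] [Fintype X] (τ ρ : ℝ) (f : ℕ),
        0 < ρ → ρ < 1 / 2 → 1 ≤ f →
        IsLSO (fun x y : X => dist x y) τ ρ →
        ∃ H : Finset (Sym2 X),
          (H.card : ℝ) ≤ C * Fintype.card X * f * τ * (1 + Real.log (Fintype.card X)) ∧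
          ∀ F : Finset X, F.card ≤ f →
            ∀ x y : X, x ∉ F → y ∉ F →
              ∃ z : X, z ∉ F ∧
                dist x z + dist z y ≤ (1 + 2 * ρ) * dist x y ∧
                (x = z ∨ s(x, z) ∈ H) ∧ (z = y ∨ s(z, y) ∈ H) := by
  classical
  refine ⟨4, by norm_num, fun X _ _ τ ρ f _ _ hf ⟨m, σ, hm, hσ, hlso⟩ => ?_⟩
  set n := Fintype.card X with hn
  have hedges (i : Fin m) : ∃ H : Finset (Sym2 X), H.card ≤ n * (f + 1) * (Nat.log 2 n + 1) ∧
      ∀ F : Finset X, F.card ≤ f → ∀ x y, x ∉ F → y ∉ F → σ i x y →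
        ∃ z, z ∉ F ∧ σ i x z ∧ σ i z y ∧ (x = z ∨ s(x, z) ∈ H) ∧ (z = y ∨ s(z, y) ∈ H) := by
    have := hσ i
    have hlen : ((Finset.univ : Finset X).sort (σ i)).length = n := by simp [hn]
    obtain ⟨H, hH, hp⟩ := exists_monotone_two_hop_edges (σ i) (fun a => refl_of (σ i) a)
      (fun a b => antisymm_of (σ i)) f (Nat.log 2 n + 1) (Finset.univ.sort (σ i))
      (Finset.pairwise_sort _ _) (Finset.sort_nodup _ _)
      (hlen ▸ Nat.lt_pow_succ_log_self one_lt_two n)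
    exact ⟨H, hlen ▸ hH, fun F hF x y => hp F hF x (by simp) y (by simp)⟩
  choose H hH hp using hedges
  refine ⟨Finset.univ.biUnion H, ?_, fun F hF x y hx hy => ?_⟩
  · have hcard : (Finset.univ.biUnion H).card ≤ m * (n * (f + 1) * (Nat.log 2 n + 1)) := by
      simpa using Finset.card_biUnion_le_card_mul Finset.univ H _ fun i _ => hH i
    have hf' : ((f + 1 : ℕ) : ℝ) ≤ 2 * f := by exact_mod_cast (by omega : f + 1 ≤ 2 * f)
    have hτ : 0 ≤ τ := (Nat.cast_nonneg m).trans hm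
    calc ((Finset.univ.biUnion H).card : ℝ)
        ≤ m * (n * (f + 1 : ℕ) * (Nat.log 2 n + 1 : ℕ)) := by exact_mod_cast hcard
      _ ≤ τ * (n * (2 * f) * (2 * (1 + Real.log n))) := by
          gcongr
          exact natLog_two_add_one_le n
      _ = 4 * n * f * τ * (1 + Real.log n) := by ring
  · have mem_H (i : Fin m) {e : Sym2 X} (he : e ∈ H i) : e ∈ Finset.univ.biUnion H :=
      Finset.mem_biUnion.mpr ⟨i, Finset.mem_univ i, he⟩
    obtain ⟨i, ⟨c, hxc, hcy, h₁, h₂⟩ | ⟨c, hyc, hcx, h₁, h₂⟩⟩ := hlso x y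
    · have := hσ i
      obtain ⟨z, hz, hxz, hzy, e₁, e₂⟩ := hp i F hF x y hx hy (trans_of (σ i) hxc hcy)
      exact ⟨z, hz, dist_add_dist_le_of_between h₁ h₂ hxz hzy, e₁.imp_right (mem_H i),
        e₂.imp_right (mem_H i)⟩
    · have := hσ i
      obtain ⟨z, hz, hyz, hzx, e₁, e₂⟩ := hp i F hF y x hy hx (trans_of (σ i) hyc hcx)
      refine ⟨z, hz, ?_, e₂.imp Eq.symm fun h => Sym2.eq_swap ▸ mem_H i h,
        e₁.imp Eq.symm fun h => Sym2.eq_swap ▸ mem_H i h⟩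
      have := dist_add_dist_le_of_between (x := y) (y := x) (c := c) (ρ := ρ) (r := σ i)
        (by simpa only [dist_comm y x] using h₁) (by simpa only [dist_comm y x] using h₂) hyz hzx
      linarith [dist_comm x z, dist_comm y z, congrArg (fun t => (1 + 2 * ρ) * t) (dist_comm x y)]
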